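/- arXiv:2009.14150 — 6 statements merged into one kernel-verified Lean document; each statement's English description precedes it below -/
import Mathlib

section
/- Let (X, d) be a separable metric space and let μ, μ₁, μ₂ be Borel probability measures on X with finite first moments. Then the doubly centred distance d_μ is square-integrable with respect to the product measure μ₁ × μ₂, i.e., ∫∫ d_μ(x,y)² dμ₁(x) dμ₂(y) < ∞. -/
open MeasureTheory

/-- The expected distance `a_μ(x) := ∫ d(x,x') dμ(x')`. -/
noncomputable def expectedDist {X : Type*} [MetricSpace X] [MeasurableSpace X]
    (μ : Measure X) (x : X) : ℝ :=
  ∫ x', dist x x' ∂μ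

/-- `D(μ) := ∫∫ d(x,x') dμ(x) dμ(x')`. -/
noncomputable def measureD {X : Type*} [MetricSpace X] [MeasurableSpace X]
    (μ : Measure X) : ℝ :=
  ∫ x, ∫ x', dist x x' ∂μ ∂μ

/-- The doubly centred distance `d_μ(x₁,x₂) := d(x₁,x₂) − a_μ(x₁) − a_μ(x₂) + D(μ)`. -/
noncomputable def centredDist {X : Type*} [MetricSpace X] [MeasurableSpace X]
    (μ : Measure X) (x₁ x₂ : X) : ℝ :=
  dist x₁ x₂ - expectedDist μ x₁ - expectedDist μ x₂ + measureD μ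

section

variable {X : Type*} [MetricSpace X] [MeasurableSpace X]

theorem expectedDist_nonneg (μ : Measure X) (x : X) : 0 ≤ expectedDist μ x :=
  integral_nonneg fun _ => dist_nonneg

variable [TopologicalSpace.SeparableSpace X] [BorelSpace X]

/-- A finite first moment at one base point is a finite first moment at every base point. -/
theorem integrable_dist_of_exists {μ : Measure X} [IsFiniteMeasure μ]
    (hμ : ∃ o : X, Integrable (fun x => dist o x) μ) (x : X) :
    Integrable (fun y => dist x y) μ := by
  obtain ⟨o, ho⟩ := hμ
  have : SecondCountableTopology X := UniformSpace.secondCountable_of_separable X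
  refine ((integrable_const (dist x o)).add ho).mono' (by fun_prop) (.of_forall fun y => ?_)
  rw [Real.norm_of_nonneg dist_nonneg]
  exact dist_triangle x o y

variable {μ : Measure X} [IsProbabilityMeasure μ]

theorem expectedDist_le_dist_add (hμ : ∃ o : X, Integrable (fun x => dist o x) μ) (x y : X) :
    expectedDist μ x ≤ dist x y + expectedDist μ y := by
  have hy := integrable_dist_of_exists hμ y
  calc expectedDist μ x ≤ ∫ z, (dist x y + dist y z) ∂μ :=
        integral_mono (integrable_dist_of_exists hμ x) ((integrable_const _).add hy)
          fun z => dist_triangle x y z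
    _ = dist x y + expectedDist μ y := by
        rw [integral_add (integrable_const _) hy]
        simp [expectedDist]

theorem dist_le_expectedDist_add (hμ : ∃ o : X, Integrable (fun x => dist o x) μ) (x y : X) :
    dist x y ≤ expectedDist μ x + expectedDist μ y := by
  have hx := integrable_dist_of_exists hμ x
  have hy := integrable_dist_of_exists hμ y
  calc dist x y = ∫ _, dist x y ∂μ := by simp
    _ ≤ ∫ z, (dist x z + dist y z) ∂μ :=
        integral_mono (integrable_const _) (hx.add hy) fun z => dist_triangle_right x y z
    _ = expectedDist μ x + expectedDist μ y := integral_add hx hy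

theorem continuous_expectedDist (hμ : ∃ o : X, Integrable (fun x => dist o x) μ) :
    Continuous (expectedDist μ) := by
  refine (LipschitzWith.of_le_add fun x y => ?_).continuous
  rw [add_comm]
  exact expectedDist_le_dist_add hμ x y

theorem integrable_expectedDist {ν : Measure X} [IsFiniteMeasure ν]
    (hμ : ∃ o : X, Integrable (fun x => dist o x) μ)
    (hν : ∃ o : X, Integrable (fun x => dist o x) ν) :
    Integrable (expectedDist μ) ν := by
  have : SecondCountableTopology X := UniformSpace.secondCountable_of_separable X
  obtain ⟨o, ho⟩ := hν
  refine (ho.add (integrable_const (expectedDist μ o))).mono'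
    (continuous_expectedDist hμ).aestronglyMeasurable (.of_forall fun x => ?_)
  rw [Real.norm_of_nonneg (expectedDist_nonneg μ x)]
  simpa only [Pi.add_apply, dist_comm o x] using expectedDist_le_dist_add hμ x o

theorem centredDist_sq_le (hμ : ∃ o : X, Integrable (fun x => dist o x) μ) (x y : X) :
    (centredDist μ x y) ^ 2 ≤
      2 * measureD μ ^ 2 + 8 * (expectedDist μ x * expectedDist μ y) := by
  set t := expectedDist μ x + expectedDist μ y - dist x y with ht
  have h₀ : 0 ≤ t := sub_nonneg.2 (dist_le_expectedDist_add hμ x y)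
  have hx : t ≤ 2 * expectedDist μ x := by
    have := expectedDist_le_dist_add hμ y x
    rw [dist_comm] at this
    linarith
  have hy : t ≤ 2 * expectedDist μ y := by
    linarith [expectedDist_le_dist_add hμ x y]
  have ht₂ : t * t ≤ 2 * expectedDist μ x * (2 * expectedDist μ y) :=
    mul_le_mul hx hy h₀ (h₀.trans hx)
  have hc : centredDist μ x y = measureD μ - t := by
    rw [centredDist, ht]
    ring
  rw [hc]
  linarith [sq_nonneg (measureD μ + t)]

end

/-- For Borel probability measures `μ, μ₁, μ₂` with finite first
moments on a separable metric space, the doubly centred distance `d_μ` is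
square-integrable with respect to `μ₁ × μ₂`. -/
theorem centredDist_sq_integrable
    {X : Type*} [MetricSpace X] [TopologicalSpace.SeparableSpace X]
    [MeasurableSpace X] [BorelSpace X]
    (μ μ₁ μ₂ : Measure X)
    [IsProbabilityMeasure μ] [IsProbabilityMeasure μ₁] [IsProbabilityMeasure μ₂]
    (hμ : ∃ o : X, Integrable (fun x => dist o x) μ)
    (hμ₁ : ∃ o : X, Integrable (fun x => dist o x) μ₁)
    (hμ₂ : ∃ o : X, Integrable (fun x => dist o x) μ₂) :
    Integrable (fun p : X × X => (centredDist μ p.1 p.2) ^ 2) (μ₁.prod μ₂) := by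
  have : SecondCountableTopology X := UniformSpace.secondCountable_of_separable X
  have hc := continuous_expectedDist hμ
  have hbound : Integrable (fun p : X × X =>
      2 * measureD μ ^ 2 + 8 * (expectedDist μ p.1 * expectedDist μ p.2)) (μ₁.prod μ₂) :=
    (integrable_const _).add
      (((integrable_expectedDist hμ hμ₁).mul_prod (integrable_expectedDist hμ hμ₂)).const_mul 8)
  refine hbound.mono' (Continuous.aestronglyMeasurable ?_) (.of_forall fun p => ?_)
  · unfold centredDist
    fun_prop
  · rw [Real.norm_of_nonneg (sq_nonneg _)]
    exact centredDist_sq_le hμ p.1 p.2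
end

section
/- Let (X, d_X) and (Y, d_Y) be separable metric spaces, let μ be a Borel probability measure on X with finite first moment and ν a Borel probability measure on Y with finite first moment. Then the distance covariance of the product measure vanishes: dcov(μ × ν) = 0. -/
open MeasureTheory

/-- The distance covariance
`dcov(θ) := ∫∫ d_μ(x,x')·d_ν(y,y') dθ((x,y)) dθ((x',y'))`, where `μ, ν` are the
marginals of `θ`. -/
noncomputable def dcov {X Y : Type*} [MetricSpace X] [MetricSpace Y]
    [MeasurableSpace X] [MeasurableSpace Y] (θ : Measure (X × Y)) : ℝ :=
  ∫ p : (X × Y) × (X × Y),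
    centredDist (θ.map Prod.fst) p.1.1 p.2.1 * centredDist (θ.map Prod.snd) p.1.2 p.2.2
    ∂(θ.prod θ)

theorem integrable_dist_prod {X : Type*} [MetricSpace X]
    [TopologicalSpace.SeparableSpace X] [MeasurableSpace X] [BorelSpace X]
    (μ : Measure X) [IsFiniteMeasure μ] {o : X} (hμ : Integrable (fun x => dist o x) μ) :
    Integrable (fun z : X × X => dist z.1 z.2) (μ.prod μ) := by
  have := UniformSpace.secondCountable_of_separable X
  refine ((hμ.comp_fst μ).add (hμ.comp_snd μ)).mono' (by fun_prop) (.of_forall fun z => ?_)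
  simpa [abs_of_nonneg dist_nonneg] using dist_triangle_left z.1 z.2 o

theorem integral_centredDist_prod {X : Type*} [MetricSpace X]
    [TopologicalSpace.SeparableSpace X] [MeasurableSpace X] [BorelSpace X]
    (μ : Measure X) [IsProbabilityMeasure μ] {o : X} (hμ : Integrable (fun x => dist o x) μ) :
    ∫ z : X × X, centredDist μ z.1 z.2 ∂(μ.prod μ) = 0 := by
  have hd := integrable_dist_prod μ hμ
  have ha : Integrable (expectedDist μ) μ := hd.integral_prod_left
  have hD : ∫ z : X × X, dist z.1 z.2 ∂(μ.prod μ) = measureD μ := integral_prod _ hd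
  have hE : ∫ x, expectedDist μ x ∂μ = measureD μ := rfl
  have h1 := ha.comp_fst μ
  have h2 := ha.comp_snd μ
  simp only [centredDist]
  rw [integral_add (by exact (hd.sub h1).sub h2) (integrable_const _),
    integral_sub (by exact hd.sub h1) h2, integral_sub hd h1, integral_fun_fst, integral_fun_snd, hD, hE]
  simp

theorem measurePreserving_prodProdProdComm {X Y : Type*} [MeasurableSpace X] [MeasurableSpace Y]
    (μ : Measure X) (ν : Measure Y) [SFinite μ] [SFinite ν] :
    MeasurePreserving
      (fun p : (X × Y) × (X × Y) => ((p.1.1, p.2.1), (p.1.2, p.2.2)))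
      ((μ.prod ν).prod (μ.prod ν)) ((μ.prod μ).prod (ν.prod ν)) := by
  have assoc_left := measurePreserving_prodAssoc μ ν (μ.prod ν)
  have assoc_mid := (MeasurePreserving.id μ).prod
    ((measurePreserving_prodAssoc ν μ ν).symm MeasurableEquiv.prodAssoc)
  have swap_mid := (MeasurePreserving.id μ).prod
    ((Measure.measurePreserving_swap (μ := ν) (ν := μ)).prod (MeasurePreserving.id ν))
  have assoc_mid' := (MeasurePreserving.id μ).prod (measurePreserving_prodAssoc μ ν ν)
  have assoc_right := (measurePreserving_prodAssoc μ μ (ν.prod ν)).symm MeasurableEquiv.prodAssoc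
  exact assoc_right.comp (assoc_mid'.comp (swap_mid.comp (assoc_mid.comp assoc_left)))

/-- The distance covariance of a product measure vanishes:
`dcov(μ × ν) = 0` for Borel probability measures `μ, ν` with finite first moments
on separable metric spaces. -/
theorem dcov_prod_eq_zero
    {X Y : Type*} [MetricSpace X] [MetricSpace Y]
    [TopologicalSpace.SeparableSpace X] [TopologicalSpace.SeparableSpace Y]
    [MeasurableSpace X] [BorelSpace X] [MeasurableSpace Y] [BorelSpace Y]
    (μ : Measure X) (ν : Measure Y)
    [IsProbabilityMeasure μ] [IsProbabilityMeasure ν]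
    (hμ : ∃ o : X, Integrable (fun x => dist o x) μ)
    (hν : ∃ o : Y, Integrable (fun y => dist o y) ν) :
    dcov (μ.prod ν) = 0 := by
  obtain ⟨o, ho⟩ := hμ
  let e : (X × Y) × (X × Y) ≃ᵐ (X × X) × (Y × Y) :=
    { Equiv.prodProdProdComm X Y X Y with
      measurable_toFun := (measurePreserving_prodProdProdComm μ ν).measurable
      measurable_invFun := by
        change Measurable fun q : (X × X) × (Y × Y) => ((q.1.1, q.2.1), (q.1.2, q.2.2))
        fun_prop }
  have he : MeasurePreserving e ((μ.prod ν).prod (μ.prod ν)) ((μ.prod μ).prod (ν.prod ν)) :=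
    measurePreserving_prodProdProdComm μ ν
  rw [dcov, Measure.map_fst_prod, Measure.map_snd_prod]
  simp only [measure_univ, one_smul]
  refine (he.integral_comp'
    (fun q => centredDist μ q.1.1 q.1.2 * centredDist ν q.2.1 q.2.2)).trans ?_
  rw [integral_prod_mul (fun z : X × X => centredDist μ z.1 z.2)
    (fun z : Y × Y => centredDist ν z.1 z.2), integral_centredDist_prod μ ho, zero_mul]
end

section
/- Let (X, d) be a metric space. Then the following are equivalent: (i) for every n ≥ 1 and all points x₁,…,xₙ, y₁,…,yₙ ∈ X, one has 2·Σ_{i,j=1}^n d(xᵢ, yⱼ) ≥ Σ_{i,j=1}^n ( d(xᵢ,xⱼ) + d(yᵢ,yⱼ) ); (ii) d is conditionally negative definite, i.e., for every n ≥ 1, all x₁,…,xₙ ∈ X and all α₁,…,αₙ ∈ ℝ with Σᵢ αᵢ = 0, one has Σ_{i,j=1}^n αᵢ αⱼ d(xᵢ,xⱼ) ≤ 0. -/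
open Filter Topology

section NegativeType

variable {X ι κ : Type*} [Fintype ι] [Fintype κ] {d : X → X → ℝ}

lemma sum_sum_comp_equiv {ι' κ' : Type*} [Fintype ι'] [Fintype κ'] (e : ι' ≃ ι) (f : κ' ≃ κ)
    (g : ι → κ → ℝ) : ∑ i, ∑ j, g (e i) (f j) = ∑ i, ∑ j, g i j := by
  rw [← e.sum_comp]
  exact Finset.sum_congr rfl fun i _ => f.sum_comp (g (e i))

/-- The negative type inequality for families indexed by `Fin n` extends to families indexed by
finite types of equal cardinality. -/
lemma sum_add_sum_le_two_mul_sum_of_card_eq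
    (h : ∀ n : ℕ, 1 ≤ n → ∀ x y : Fin n → X,
      ∑ i, ∑ j, (d (x i) (x j) + d (y i) (y j)) ≤ 2 * ∑ i, ∑ j, d (x i) (y j))
    (hcard : Fintype.card ι = Fintype.card κ) (x : ι → X) (y : κ → X) :
    ∑ i, ∑ j, d (x i) (x j) + ∑ i, ∑ j, d (y i) (y j) ≤ 2 * ∑ i, ∑ j, d (x i) (y j) := by
  let e := (Fintype.equivFin ι).symm
  let f := (Fintype.equivFinOfCardEq hcard.symm).symm
  have key : ∑ i, ∑ j, (d (x (e i)) (x (e j)) + d (y (f i)) (y (f j))) ≤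
      2 * ∑ i, ∑ j, d (x (e i)) (y (f j)) := by
    rcases Nat.eq_zero_or_pos (Fintype.card ι) with h0 | hpos
    · have : IsEmpty (Fin (Fintype.card ι)) := by rw [h0]; infer_instance
      simp
    · exact h _ hpos (x ∘ e) (y ∘ f)
  simp only [Finset.sum_add_distrib] at key
  rwa [sum_sum_comp_equiv e e fun i j => d (x i) (x j),
    sum_sum_comp_equiv f f fun i j => d (y i) (y j),
    sum_sum_comp_equiv e f fun i j => d (x i) (y j)] at key

lemma sum_sigma_fin_fst (p : ι → ℕ) (f : ι → ℝ) :
    ∑ s : (Σ i, Fin (p i)), f s.1 = ∑ i, p i * f i := by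
  simp [Fintype.sum_sigma]

lemma sum_sigma_fin_sum_sigma_fin (p q : ι → ℕ) (f : ι → ι → ℝ) :
    ∑ s : (Σ i, Fin (p i)), ∑ t : (Σ i, Fin (q i)), f s.1 t.1 =
      ∑ i, ∑ j, p i * q j * f i j := by
  simp only [sum_sigma_fin_fst q, sum_sigma_fin_fst p fun i => ∑ j, q j * f i j,
    Finset.mul_sum, mul_assoc]

/-- Negative type implies the conditional negative definiteness inequality for integer weights. -/
lemma sum_int_mul_le_zero (hsymm : ∀ a b, d a b = d b a)
    (h : ∀ n : ℕ, 1 ≤ n → ∀ x y : Fin n → X,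
      ∑ i, ∑ j, (d (x i) (x j) + d (y i) (y j)) ≤ 2 * ∑ i, ∑ j, d (x i) (y j))
    (x : ι → X) (c : ι → ℤ) (hc : ∑ i, c i = 0) :
    ∑ i, ∑ j, (c i : ℝ) * c j * d (x i) (x j) ≤ 0 := by
  let p : ι → ℕ := fun i => (c i).toNat
  let q : ι → ℕ := fun i => (-c i).toNat
  have hpq : ∀ i, c i = (p i : ℤ) - q i := fun i => (Int.toNat_sub_toNat_neg (c i)).symm
  have hcard : Fintype.card (Σ i, Fin (p i)) = Fintype.card (Σ i, Fin (q i)) := by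
    simp only [hpq, Finset.sum_sub_distrib, sub_eq_zero] at hc
    simpa using mod_cast hc
  have key := sum_add_sum_le_two_mul_sum_of_card_eq h hcard (fun s => x s.1) (fun s => x s.1)
  simp only [sum_sigma_fin_sum_sigma_fin _ _ fun i j => d (x i) (x j)] at key
  have hswap : ∑ i, ∑ j, (q i : ℝ) * p j * d (x i) (x j) =
      ∑ i, ∑ j, (p i : ℝ) * q j * d (x i) (x j) := by
    rw [Finset.sum_comm]
    refine Finset.sum_congr rfl fun i _ => Finset.sum_congr rfl fun j _ => ?_
    rw [hsymm, mul_comm (q j : ℝ)]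
  have hexp : ∑ i, ∑ j, (c i : ℝ) * c j * d (x i) (x j) =
      ∑ i, ∑ j, (p i : ℝ) * p j * d (x i) (x j) + ∑ i, ∑ j, (q i : ℝ) * q j * d (x i) (x j) -
        ∑ i, ∑ j, (p i : ℝ) * q j * d (x i) (x j) -
        ∑ i, ∑ j, (q i : ℝ) * p j * d (x i) (x j) := by
    simp only [← Finset.sum_add_distrib, ← Finset.sum_sub_distrib]
    refine Finset.sum_congr rfl fun i _ => Finset.sum_congr rfl fun j _ => ?_
    rw [hpq i, hpq j]
    push_cast
    ring
  linarith

lemma tendsto_floor_natCast_mul_div (a : ℝ) :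
    Tendsto (fun N : ℕ => (⌊(N : ℝ) * a⌋ : ℝ) / N) atTop (𝓝 a) := by
  have hlow : Tendsto (fun N : ℕ => a - 1 / (N : ℝ)) atTop (𝓝 a) := by
    simpa using tendsto_const_nhds.sub (tendsto_one_div_atTop_nhds_zero_nat (𝕜 := ℝ))
  refine tendsto_of_tendsto_of_tendsto_of_le_of_le' hlow tendsto_const_nhds ?_ ?_ <;>
    filter_upwards [eventually_gt_atTop 0] with N hN <;>
    have hN' : (0 : ℝ) < N := Nat.cast_pos.2 hN
  · rw [le_div_iff₀ hN', sub_mul, one_div_mul_cancel hN'.ne']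
    linarith [Int.lt_floor_add_one ((N : ℝ) * a)]
  · rw [div_le_iff₀ hN']
    linarith [Int.floor_le ((N : ℝ) * a)]

/-- A quadratic inequality on integer weights of zero sum extends to real weights of zero sum. -/
lemma sum_mul_le_zero_of_int (A : ι → ι → ℝ)
    (h : ∀ c : ι → ℤ, ∑ i, c i = 0 → ∑ i, ∑ j, (c i : ℝ) * c j * A i j ≤ 0)
    (α : ι → ℝ) (hα : ∑ i, α i = 0) :
    ∑ i, ∑ j, α i * α j * A i j ≤ 0 := by
  classical
  rcases isEmpty_or_nonempty ι with _ | ⟨⟨k⟩⟩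
  · simp
  -- Moving the excess mass of `β` to the point `k` gives weights of zero sum.
  let shift : (ι → ℝ) → ι → ℝ := fun β i => β i - if i = k then ∑ l, β l else 0
  let Q : (ι → ℝ) → ℝ := fun β => ∑ i, ∑ j, shift β i * shift β j * A i j
  have hshift : ∀ i, Continuous fun β => shift β i := fun i => by
    by_cases hi : i = k <;> simp only [shift, hi, if_true, if_false] <;> fun_prop
  have hQ : Continuous Q := by fun_prop
  have hlim : Tendsto (fun N : ℕ => Q fun i => (⌊(N : ℝ) * α i⌋ : ℝ) / N) atTop (𝓝 (Q α)) :=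
    (hQ.tendsto α).comp (tendsto_pi_nhds.2 fun i => tendsto_floor_natCast_mul_div (α i))
  have hQα : Q α = ∑ i, ∑ j, α i * α j * A i j := by simp [Q, shift, hα]
  rw [← hQα]
  refine le_of_tendsto' hlim fun N => ?_
  let b : ι → ℤ := fun i => ⌊(N : ℝ) * α i⌋
  let c : ι → ℤ := fun i => b i - if i = k then ∑ l, b l else 0
  have hc : ∑ i, c i = 0 := by simp [c]
  have hcb : ∀ i, shift (fun i => (b i : ℝ) / N) i = (c i : ℝ) / N := fun i => by
    by_cases hi : i = k <;> simp [shift, c, hi, sub_div, Finset.sum_div]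
  have hscale : Q (fun i => (b i : ℝ) / N) =
      (∑ i, ∑ j, (c i : ℝ) * c j * A i j) * ((N : ℝ)⁻¹) ^ 2 := by
    simp only [Q, hcb, Finset.sum_mul]
    refine Finset.sum_congr rfl fun i _ => Finset.sum_congr rfl fun j _ => ?_
    ring
  exact hscale.trans_le (mul_nonpos_of_nonpos_of_nonneg (h c hc) (sq_nonneg _))

/-- Conditional negative definiteness implies the negative type inequality. -/
lemma sum_add_le_two_mul_sum_of_sum_mul_le_zero (hsymm : ∀ a b, d a b = d b a)
    (h : ∀ n : ℕ, 1 ≤ n → ∀ x : Fin n → X, ∀ α : Fin n → ℝ, ∑ i, α i = 0 →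
      ∑ i, ∑ j, α i * α j * d (x i) (x j) ≤ 0)
    (n : ℕ) (hn : 1 ≤ n) (x y : Fin n → X) :
    ∑ i, ∑ j, (d (x i) (x j) + d (y i) (y j)) ≤ 2 * ∑ i, ∑ j, d (x i) (y j) := by
  have key := h (n + n) (by omega) (Fin.append x y) (Fin.append (fun _ => 1) (fun _ => -1))
    (by simp only [Fin.sum_univ_add, Fin.append_left, Fin.append_right]; simp)
  have hswap : ∑ i, ∑ j, d (y i) (x j) = ∑ i, ∑ j, d (x i) (y j) := by
    rw [Finset.sum_comm]
    simp only [hsymm]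
  simp only [Fin.sum_univ_add, Fin.append_left, Fin.append_right, Finset.sum_add_distrib,
    one_mul, mul_one, neg_mul, neg_neg, Finset.sum_neg_distrib] at key ⊢
  linarith

end NegativeType


/-- For a metric space `(X,d)`, the "negative type" inequality
`2 Σᵢⱼ d(xᵢ,yⱼ) ≥ Σᵢⱼ (d(xᵢ,xⱼ) + d(yᵢ,yⱼ))` for all finite families of points
is equivalent to `d` being conditionally negative definite. -/
theorem negType_iff_conditionallyNegDef
    {X : Type*} [MetricSpace X] :
    (∀ n : ℕ, 1 ≤ n → ∀ x y : Fin n → X,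
        ∑ i : Fin n, ∑ j : Fin n, (dist (x i) (x j) + dist (y i) (y j)) ≤
          2 * ∑ i : Fin n, ∑ j : Fin n, dist (x i) (y j)) ↔
    (∀ n : ℕ, 1 ≤ n → ∀ x : Fin n → X, ∀ α : Fin n → ℝ, (∑ i : Fin n, α i) = 0 →
        ∑ i : Fin n, ∑ j : Fin n, α i * α j * dist (x i) (x j) ≤ 0) := by
  exact ⟨fun h _ _ x α hα => sum_mul_le_zero_of_int _ (sum_int_mul_le_zero dist_comm h x) α hα,
    fun h => sum_add_le_two_mul_sum_of_sum_mul_le_zero dist_comm h⟩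
end

section
/- Let (X, d) be a metric space. Then (X, d) has negative type if and only if there exists a point o ∈ X such that the absolute antipodal divergence d_o(x,y) := d(x,o) + d(y,o) − d(x,y) is a positive definite kernel on X, i.e., for every n ≥ 1, all x₁,…,xₙ ∈ X and all α₁,…,αₙ ∈ ℝ, Σ_{i,j=1}^n αᵢ αⱼ d_o(xᵢ,xⱼ) ≥ 0. -/
/-- A metric space has negative type if its metric is conditionally negative
definite. -/
def NegativeType (X : Type*) [MetricSpace X] : Prop :=
  ∀ n : ℕ, 1 ≤ n → ∀ x : Fin n → X, ∀ α : Fin n → ℝ, (∑ i : Fin n, α i) = 0 →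
    ∑ i : Fin n, ∑ j : Fin n, α i * α j * dist (x i) (x j) ≤ 0

theorem sum_antipodal_eq {X : Type*} [PseudoMetricSpace X] {ι : Type*} [Fintype ι]
    (o : X) (x : ι → X) (α : ι → ℝ) :
    ∑ i, ∑ j, α i * α j * (dist (x i) o + dist (x j) o - dist (x i) (x j)) =
      2 * (∑ i, α i) * (∑ i, α i * dist (x i) o) -
        ∑ i, ∑ j, α i * α j * dist (x i) (x j) := by
  have h₁ : ∑ i, ∑ j, α i * α j * dist (x i) o = (∑ i, α i * dist (x i) o) * ∑ j, α j := by
    rw [Finset.sum_mul_sum]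
    exact Finset.sum_congr rfl fun i _ => Finset.sum_congr rfl fun j _ => by ring
  have h₂ : ∑ i, ∑ j, α i * α j * dist (x j) o = (∑ i, α i) * ∑ j, α j * dist (x j) o := by
    rw [Finset.sum_mul_sum]
    exact Finset.sum_congr rfl fun i _ => Finset.sum_congr rfl fun j _ => by ring
  simp only [mul_sub, mul_add, Finset.sum_sub_distrib, Finset.sum_add_distrib, h₁, h₂]
  ring

theorem sum_dist_cons_eq {X : Type*} [PseudoMetricSpace X] {n : ℕ}
    (o : X) (c : ℝ) (x : Fin n → X) (α : Fin n → ℝ) :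
    ∑ i : Fin (n + 1), ∑ j : Fin (n + 1),
        (Fin.cons c α : Fin (n + 1) → ℝ) i * (Fin.cons c α : Fin (n + 1) → ℝ) j *
          dist ((Fin.cons o x : Fin (n + 1) → X) i) ((Fin.cons o x : Fin (n + 1) → X) j) =
      2 * c * (∑ i, α i * dist (x i) o) + ∑ i, ∑ j, α i * α j * dist (x i) (x j) := by
  have h₁ : ∑ j, c * α j * dist o (x j) = c * ∑ i, α i * dist (x i) o := by
    rw [Finset.mul_sum]
    exact Finset.sum_congr rfl fun j _ => by rw [dist_comm]; ring
  have h₂ : ∑ i, α i * c * dist (x i) o = c * ∑ i, α i * dist (x i) o := by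
    rw [Finset.mul_sum]
    exact Finset.sum_congr rfl fun i _ => by ring
  simp only [Fin.sum_univ_succ, Fin.cons_zero, Fin.cons_succ, Finset.sum_add_distrib, dist_self,
    h₁, h₂]
  ring

/-- A metric space has negative type iff there is a point `o` for
which the absolute antipodal divergence
`d_o(x,y) := d(x,o) + d(y,o) − d(x,y)` is a positive definite kernel. -/
theorem negativeType_iff_antipodal_posdef
    {X : Type*} [MetricSpace X] [Nonempty X] :
    NegativeType X ↔
      ∃ o : X, ∀ n : ℕ, 1 ≤ n → ∀ x : Fin n → X, ∀ α : Fin n → ℝ,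
        0 ≤ ∑ i : Fin n, ∑ j : Fin n,
              α i * α j * (dist (x i) o + dist (x j) o - dist (x i) (x j)) := by
  constructor
  · intro h
    obtain ⟨o⟩ := ‹Nonempty X›
    refine ⟨o, fun n _ x α => ?_⟩
    have key := h (n + 1) (Nat.le_add_left 1 n) (Fin.cons o x) (Fin.cons (-∑ i, α i) α)
      (by simp [Fin.sum_univ_succ])
    rw [sum_dist_cons_eq] at key
    rw [sum_antipodal_eq]
    linarith
  · rintro ⟨o, h⟩ n hn x α hα
    have key := h n hn x α
    rw [sum_antipodal_eq, hα] at key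
    linarith
end

section
/- (Schoenberg's theorem) Let (X, d) be a metric space. Then (X, d) has negative type if and only if there exist a real Hilbert space H and a map φ : X → H such that ‖φ(x) − φ(y)‖² = d(x,y) for all x, y ∈ X, i.e., (X, √d) embeds isometrically into a Hilbert space. -/
universe u

/-- The bilinear form on finitely supported functions with kernel `-dist / 2`. -/
noncomputable def negHalfDistForm (X : Type*) [MetricSpace X] :
    (X →₀ ℝ) →ₗ[ℝ] (X →₀ ℝ) →ₗ[ℝ] ℝ :=
  Finsupp.linearCombination ℝ fun x => Finsupp.linearCombination ℝ fun y => -dist x y / 2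

theorem negHalfDistForm_single {X : Type*} [MetricSpace X] (x y : X) (a b : ℝ) :
    negHalfDistForm X (Finsupp.single x a) (Finsupp.single y b) = a * (b * (-dist x y / 2)) := by
  simp [negHalfDistForm, Finsupp.linearCombination_single]

theorem negHalfDistForm_symm {X : Type*} [MetricSpace X] (f g : X →₀ ℝ) :
    negHalfDistForm X f g = negHalfDistForm X g f := by
  have h : negHalfDistForm X = (negHalfDistForm X).flip := by
    ext x y
    simp [negHalfDistForm_single, dist_comm]
  exact congrArg (fun B => B f g) h

theorem negHalfDistForm_apply {X : Type*} [MetricSpace X] (f g : X →₀ ℝ) :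
    negHalfDistForm X f g =
      ∑ x ∈ f.support, ∑ y ∈ g.support, f x * (g y * (-dist x y / 2)) := by
  simp [negHalfDistForm, Finsupp.linearCombination_apply, Finsupp.sum, Finset.mul_sum]

theorem NegativeType.sum_finset_nonpos {X : Type*} [MetricSpace X] (h : NegativeType X)
    (s : Finset X) (α : X → ℝ) (hα : ∑ x ∈ s, α x = 0) :
    ∑ x ∈ s, ∑ y ∈ s, α x * α y * dist x y ≤ 0 := by
  rcases s.eq_empty_or_nonempty with rfl | hs
  · simp
  have sum_eq (f : X → ℝ) : ∑ i : Fin s.card, f (s.equivFin.symm i) = ∑ x ∈ s, f x := by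
    rw [Equiv.sum_comp s.equivFin.symm fun x : s => f x, Finset.sum_coe_sort s f]
  have key := h s.card hs.card_pos (fun i => s.equivFin.symm i)
    (fun i => α (s.equivFin.symm i)) ((sum_eq α).trans hα)
  simp only [fun x : X => sum_eq fun y => α x * α y * dist x y] at key
  rwa [sum_eq fun x => ∑ y ∈ s, α x * α y * dist x y] at key

theorem NegativeType.negHalfDistForm_self_nonneg {X : Type*} [MetricSpace X]
    (h : NegativeType X) {f : X →₀ ℝ} (hf : Finsupp.linearCombination ℝ (fun _ => (1 : ℝ)) f = 0) :
    0 ≤ negHalfDistForm X f f := by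
  have key := h.sum_finset_nonpos f.support f
    (by simpa [Finsupp.linearCombination_apply, Finsupp.sum] using hf)
  have heq : negHalfDistForm X f f =
      (-1 / 2) * ∑ x ∈ f.support, ∑ y ∈ f.support, f x * f y * dist x y := by
    simp only [negHalfDistForm_apply, Finset.mul_sum]
    exact Finset.sum_congr rfl fun x _ => Finset.sum_congr rfl fun y _ => by ring
  linarith

/-- The space of finitely supported functions with total mass zero. -/
noncomputable abbrev ZeroSumFinsupp (X : Type*) : Submodule ℝ (X →₀ ℝ) :=
  LinearMap.ker (Finsupp.linearCombination ℝ fun _ : X => (1 : ℝ))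

/-- On a space of negative type, `negHalfDistForm` is a semi-inner product on the functions of
total mass zero. -/
@[reducible]
noncomputable def NegativeType.core {X : Type*} [MetricSpace X] (h : NegativeType X) :
    PreInnerProductSpace.Core ℝ (ZeroSumFinsupp X) where
  inner f g := negHalfDistForm X f g
  conj_inner_symm f g := negHalfDistForm_symm _ _
  re_inner_nonneg f := h.negHalfDistForm_self_nonneg f.2
  add_left f g k := by simp
  smul_left f g r := by simp

theorem NegativeType.exists_hilbert_embedding {X : Type u} [MetricSpace X] (h : NegativeType X) :
    ∃ (H : Type u) (_ : NormedAddCommGroup H) (_ : InnerProductSpace ℝ H)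
      (_ : CompleteSpace H) (φ : X → H), ∀ x y : X, ‖φ x - φ y‖ ^ 2 = dist x y := by
  let core := h.core
  let : SeminormedAddCommGroup (ZeroSumFinsupp X) :=
    InnerProductSpace.Core.toSeminormedAddCommGroup (𝕜 := ℝ)
  let : InnerProductSpace ℝ (ZeroSumFinsupp X) := InnerProductSpace.ofCore core
  refine ⟨UniformSpace.Completion (ZeroSumFinsupp X), inferInstance, inferInstance,
    inferInstance, ?_⟩
  rcases isEmpty_or_nonempty X with hX | ⟨⟨o⟩⟩
  · exact ⟨isEmptyElim, isEmptyElim⟩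
  let ψ (x : X) : ZeroSumFinsupp X :=
    ⟨Finsupp.single x 1 - Finsupp.single o 1, by simp [LinearMap.mem_ker]⟩
  refine ⟨fun x => ψ x, fun x y => ?_⟩
  have hψ : ((ψ x - ψ y : ZeroSumFinsupp X) : X →₀ ℝ) =
      Finsupp.single x 1 - Finsupp.single y 1 := by
    simp [ψ]
  rw [← UniformSpace.Completion.coe_sub, UniformSpace.Completion.norm_coe,
    ← real_inner_self_eq_norm_sq]
  change negHalfDistForm X (ψ x - ψ y : ZeroSumFinsupp X) (ψ x - ψ y : ZeroSumFinsupp X) = _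
  rw [hψ]
  simp only [map_sub, LinearMap.sub_apply, negHalfDistForm_single, dist_self, dist_comm y x]
  ring

theorem NegativeType.of_norm_sub_sq_eq_dist {X H : Type*} [MetricSpace X]
    [SeminormedAddCommGroup H] [InnerProductSpace ℝ H] (φ : X → H)
    (hφ : ∀ x y : X, ‖φ x - φ y‖ ^ 2 = dist x y) : NegativeType X := by
  intro n _ x α hα
  have key := inner_sum_smul_sum_smul_of_sum_eq_zero (fun i => φ (x i)) hα
    (fun i => φ (x i)) hα
  simp only [← pow_two, hφ] at key
  have := real_inner_self_nonneg (x := ∑ i, α i • φ (x i))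
  linarith

/-- Schoenberg's theorem: A metric space `(X,d)` has negative type
iff `(X, √d)` embeds isometrically into a real Hilbert space, i.e. there are a real
Hilbert space `H` and `φ : X → H` with `‖φ(x) − φ(y)‖² = d(x,y)` for all `x, y`. -/
theorem negativeType_iff_hilbert_embedding
    {X : Type u} [MetricSpace X] :
    NegativeType X ↔
      ∃ (H : Type u) (_ : NormedAddCommGroup H) (_ : InnerProductSpace ℝ H)
        (_ : CompleteSpace H) (φ : X → H),
        ∀ x y : X, ‖φ x - φ y‖ ^ 2 = dist x y :=
  ⟨fun h => h.exists_hilbert_embedding, fun ⟨_, _, _, _, φ, hφ⟩ => .of_norm_sub_sq_eq_dist φ hφ⟩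
end

section
/- Let (X, d_X) and (Y, d_Y) be separable metric spaces with X containing at least two points. Suppose (Y, d_Y) is not of strong negative type, i.e., there exist two distinct Borel probability measures ν₁ ≠ ν₂ on Y with finite first moments such that D(ν₁ − ν₂) = 0. Let x₁ ≠ x₂ be two distinct points of X and define θ := (δ_{x₁} × ν₁ + δ_{x₂} × ν₂)/2, a Borel probability measure on X × Y. Then dcov(θ) = 0, yet θ is not equal to the product of its two marginals. -/
open MeasureTheory

section Mixture

variable {X Y : Type*} [MeasurableSpace X] [MeasurableSpace Y]

lemma integrable_and_integral_mul_dirac_prod (x x' : X) (ν ν' : Measure Y)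
    [SFinite ν] [SFinite ν'] (f : X × X → ℝ) (g : Y × Y → ℝ) (hf : Measurable f)
    (hg : Measurable g) (hgi : Integrable g (ν.prod ν')) :
    Integrable (fun p : (X × Y) × (X × Y) => f (p.1.1, p.2.1) * g (p.1.2, p.2.2))
        (((Measure.dirac x).prod ν).prod ((Measure.dirac x').prod ν')) ∧
      ∫ p : (X × Y) × (X × Y), f (p.1.1, p.2.1) * g (p.1.2, p.2.2)
          ∂(((Measure.dirac x).prod ν).prod ((Measure.dirac x').prod ν')) =
        f (x, x') * ∫ p, g p ∂(ν.prod ν') := by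
  have hF : Measurable (fun p : (X × Y) × (X × Y) => f (p.1.1, p.2.1) * g (p.1.2, p.2.2)) := by
    fun_prop
  have hm : Measurable (Prod.map (Prod.mk x : Y → X × Y) (Prod.mk x' : Y → X × Y)) := by
    fun_prop
  rw [Measure.dirac_prod, Measure.dirac_prod,
    Measure.map_prod_map _ _ measurable_prodMk_left measurable_prodMk_left,
    integrable_map_measure hF.aestronglyMeasurable hm.aemeasurable,
    integral_map hm.aemeasurable hF.aestronglyMeasurable]
  exact ⟨hgi.const_mul (f (x, x')), integral_const_mul (f (x, x')) g⟩

lemma map_fst_half_dirac_prod_add (x₁ x₂ : X) (ν₁ ν₂ : Measure Y)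
    [IsProbabilityMeasure ν₁] [IsProbabilityMeasure ν₂] :
    ((2 : ENNReal)⁻¹ • ((Measure.dirac x₁).prod ν₁ + (Measure.dirac x₂).prod ν₂)).map Prod.fst =
      (2 : ENNReal)⁻¹ • (Measure.dirac x₁ + Measure.dirac x₂) := by
  rw [Measure.map_smul, Measure.map_add _ _ measurable_fst]
  simp [Measure.map_fst_prod]

lemma map_snd_half_dirac_prod_add (x₁ x₂ : X) (ν₁ ν₂ : Measure Y) [SFinite ν₁] [SFinite ν₂] :
    ((2 : ENNReal)⁻¹ • ((Measure.dirac x₁).prod ν₁ + (Measure.dirac x₂).prod ν₂)).map Prod.snd =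
      (2 : ENNReal)⁻¹ • (ν₁ + ν₂) := by
  rw [Measure.map_smul, Measure.map_add _ _ measurable_snd]
  simp [Measure.map_snd_prod]

lemma integral_half_add_prod_self {Z : Type*} [MeasurableSpace Z] (α β : Measure Z)
    [SFinite α] [SFinite β] (F : Z × Z → ℝ)
    (h₁ : Integrable F (α.prod α)) (h₂ : Integrable F (α.prod β))
    (h₃ : Integrable F (β.prod α)) (h₄ : Integrable F (β.prod β)) :
    ∫ p, F p ∂(((2 : ENNReal)⁻¹ • (α + β)).prod ((2 : ENNReal)⁻¹ • (α + β))) =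
      4⁻¹ * (∫ p, F p ∂(α.prod α) + ∫ p, F p ∂(α.prod β) +
        ∫ p, F p ∂(β.prod α) + ∫ p, F p ∂(β.prod β)) := by
  rw [Measure.prod_smul_left, Measure.prod_smul_right, Measure.add_prod, Measure.prod_add,
    Measure.prod_add, integral_smul_measure, integral_smul_measure,
    integral_add_measure (h₁.add_measure h₂) (h₃.add_measure h₄),
    integral_add_measure h₁ h₂, integral_add_measure h₃ h₄]
  simp only [ENNReal.toReal_inv, ENNReal.toReal_ofNat, smul_eq_mul]
  ring

lemma eq_of_half_dirac_prod_add_eq_prod [MeasurableSingletonClass X] {x₁ x₂ : X} (hx : x₁ ≠ x₂)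
    (ν₁ ν₂ : Measure Y) [IsFiniteMeasure ν₁] [IsFiniteMeasure ν₂]
    (h : (2 : ENNReal)⁻¹ • ((Measure.dirac x₁).prod ν₁ + (Measure.dirac x₂).prod ν₂) =
      ((2 : ENNReal)⁻¹ • (Measure.dirac x₁ + Measure.dirac x₂)).prod
        ((2 : ENNReal)⁻¹ • (ν₁ + ν₂))) : ν₁ = ν₂ := by
  ext B _
  have hB := congrArg (fun m : Measure (X × Y) => (m ({x₁} ×ˢ B)).toReal) h
  simp [Measure.prod_prod, hx.symm] at hB
  rw [ENNReal.toReal_add (by finiteness) (by finiteness)] at hB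
  simp only [ENNReal.toReal_mul, ENNReal.toReal_inv, ENNReal.toReal_ofNat] at hB
  rw [← ENNReal.toReal_eq_toReal_iff' (measure_ne_top _ _) (measure_ne_top _ _)]
  linarith

end Mixture

section CentredDist

variable {X Y : Type*} [MetricSpace X] [MetricSpace Y] [MeasurableSpace X] [MeasurableSpace Y]

lemma integrable_dist_of_exists_s14 [OpensMeasurableSpace Y] (ν : Measure Y) [IsFiniteMeasure ν]
    (h : ∃ o : Y, Integrable (fun y => dist o y) ν) (z : Y) :
    Integrable (fun y => dist z y) ν := by
  obtain ⟨o, ho⟩ := h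
  refine ((integrable_const (dist z o)).add ho).mono'
    (continuous_const.dist continuous_id).measurable.aestronglyMeasurable (ae_of_all _ fun y => ?_)
  simpa using dist_triangle z o y

lemma integrable_dist_prod_s14 [SecondCountableTopology Y] [OpensMeasurableSpace Y]
    (ν ν' : Measure Y) [IsFiniteMeasure ν] [IsFiniteMeasure ν'] (o : Y)
    (h : Integrable (fun y => dist o y) ν) (h' : Integrable (fun y => dist o y) ν') :
    Integrable (fun p : Y × Y => dist p.1 p.2) (ν.prod ν') := by
  refine ((h.comp_fst ν').add (h'.comp_snd ν)).mono'
    (measurable_fst.dist measurable_snd).aestronglyMeasurable (ae_of_all _ fun p => ?_)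
  simpa using dist_triangle_left p.1 p.2 o

lemma measurable_expectedDist [SecondCountableTopology Y] [OpensMeasurableSpace Y]
    (ν : Measure Y) [SFinite ν] : Measurable (expectedDist ν) := by
  have h : StronglyMeasurable (fun p : Y × Y => dist p.1 p.2) :=
    (measurable_fst.dist measurable_snd).stronglyMeasurable
  exact h.integral_prod_right.measurable

lemma measurable_centredDist [SecondCountableTopology Y] [OpensMeasurableSpace Y]
    (ν : Measure Y) [SFinite ν] :
    Measurable (fun p : Y × Y => centredDist ν p.1 p.2) :=
  (((measurable_fst.dist measurable_snd).sub
    ((measurable_expectedDist ν).comp measurable_fst)).sub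
    ((measurable_expectedDist ν).comp measurable_snd)).add_const _

lemma integrable_centredDist_and_integral_eq [SecondCountableTopology Y] [OpensMeasurableSpace Y]
    (ν₀ ν ν' : Measure Y) [IsFiniteMeasure ν₀] [IsProbabilityMeasure ν] [IsProbabilityMeasure ν']
    (o : Y) (h₀ : Integrable (fun y => dist o y) ν₀)
    (h : Integrable (fun y => dist o y) ν) (h' : Integrable (fun y => dist o y) ν') :
    Integrable (fun p : Y × Y => centredDist ν₀ p.1 p.2) (ν.prod ν') ∧
      ∫ p, centredDist ν₀ p.1 p.2 ∂(ν.prod ν') =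
        (∫ y, ∫ y', dist y y' ∂ν' ∂ν) - (∫ y, expectedDist ν₀ y ∂ν)
          - (∫ y, expectedDist ν₀ y ∂ν') + measureD ν₀ := by
  have hd := integrable_dist_prod_s14 ν ν' o h h'
  have ha : Integrable (expectedDist ν₀) ν :=
    (integrable_dist_prod_s14 ν ν₀ o h h₀).integral_prod_left
  have ha' : Integrable (expectedDist ν₀) ν' :=
    (integrable_dist_prod_s14 ν' ν₀ o h' h₀).integral_prod_left
  have ha₁ := ha.comp_fst ν'
  have ha₂ := ha'.comp_snd ν
  refine ⟨((hd.sub ha₁).sub ha₂).add (integrable_const (measureD ν₀)), ?_⟩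
  have hfst : ∫ p : Y × Y, expectedDist ν₀ p.1 ∂(ν.prod ν') = ∫ y, expectedDist ν₀ y ∂ν := by
    simpa using integral_fun_fst (μ := ν) (ν := ν') (expectedDist ν₀)
  have hsnd : ∫ p : Y × Y, expectedDist ν₀ p.2 ∂(ν.prod ν') = ∫ y, expectedDist ν₀ y ∂ν' := by
    simpa using integral_fun_snd (μ := ν) (ν := ν') (expectedDist ν₀)
  unfold centredDist
  rw [integral_add (by exact (hd.sub ha₁).sub ha₂) (integrable_const _),
    integral_sub (by exact hd.sub ha₁) ha₂, integral_sub hd ha₁, hfst, hsnd,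
    integral_prod _ hd]
  simp

lemma centredDist_half_dirac_add [BorelSpace X] (x₁ x₂ : X) :
    let μ := (2 : ENNReal)⁻¹ • (Measure.dirac x₁ + Measure.dirac x₂)
    centredDist μ x₁ x₁ = -(dist x₁ x₂ / 2) ∧ centredDist μ x₂ x₂ = -(dist x₁ x₂ / 2) ∧
      centredDist μ x₁ x₂ = dist x₁ x₂ / 2 ∧ centredDist μ x₂ x₁ = dist x₁ x₂ / 2 := by
  intro μ
  have hint (f : X → ℝ) : ∫ x, f x ∂μ = 2⁻¹ * (f x₁ + f x₂) := by
    simp only [μ]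
    rw [integral_smul_measure, integral_add_measure (integrable_dirac (by simp))
      (integrable_dirac (by simp))]
    simp
  simp only [centredDist, expectedDist, measureD, hint, dist_self, dist_comm x₂ x₁]
  refine ⟨?_, ?_, ?_, ?_⟩ <;> ring

end CentredDist

/-- If `Y` is not of strong negative type, witnessed by two distinct
Borel probability measures `ν₁ ≠ ν₂` with finite first moments and `D(ν₁ − ν₂) = 0`,
and `x₁ ≠ x₂` are points of `X`, then `θ := (δ_{x₁} × ν₁ + δ_{x₂} × ν₂)/2`
satisfies `dcov(θ) = 0` while `θ` is not the product of its marginals. -/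
theorem dcov_zero_but_not_product
    {X Y : Type*} [MetricSpace X] [MetricSpace Y]
    [TopologicalSpace.SeparableSpace X] [TopologicalSpace.SeparableSpace Y]
    [MeasurableSpace X] [BorelSpace X] [MeasurableSpace Y] [BorelSpace Y]
    (ν₁ ν₂ : Measure Y) [IsProbabilityMeasure ν₁] [IsProbabilityMeasure ν₂]
    (hν₁ : ∃ o : Y, Integrable (fun y => dist o y) ν₁)
    (hν₂ : ∃ o : Y, Integrable (fun y => dist o y) ν₂)
    (hne : ν₁ ≠ ν₂)
    (hD : measureD ν₁ + measureD ν₂ - 2 * (∫ y, ∫ y', dist y y' ∂ν₂ ∂ν₁) = 0)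
    (x₁ x₂ : X) (hx : x₁ ≠ x₂)
    (θ : Measure (X × Y))
    (hθ : θ = (2 : ENNReal)⁻¹ •
      (((Measure.dirac x₁).prod ν₁) + ((Measure.dirac x₂).prod ν₂))) :
    dcov θ = 0 ∧ θ ≠ (θ.map Prod.fst).prod (θ.map Prod.snd) := by
  have : SecondCountableTopology X := UniformSpace.secondCountable_of_separable X
  have : SecondCountableTopology Y := UniformSpace.secondCountable_of_separable Y
  obtain ⟨o, h₁⟩ := hν₁
  have h₂ := integrable_dist_of_exists_s14 ν₂ hν₂ o
  have hfst := map_fst_half_dirac_prod_add x₁ x₂ ν₁ ν₂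
  have hsnd := map_snd_half_dirac_prod_add x₁ x₂ ν₁ ν₂
  rw [← hθ] at hfst hsnd
  refine ⟨?_, fun h => hne ?_⟩
  · obtain ⟨c₁₁, c₂₂, c₁₂, c₂₁⟩ := centredDist_half_dirac_add x₁ x₂
    set μ := (2 : ENNReal)⁻¹ • (Measure.dirac x₁ + Measure.dirac x₂)
    set ν := (2 : ENNReal)⁻¹ • (ν₁ + ν₂)
    have : IsFiniteMeasure μ := Measure.smul_finite _ (by simp)
    have : IsFiniteMeasure ν := Measure.smul_finite _ (by simp)
    have h₀ : Integrable (fun y => dist o y) ν := (h₁.add_measure h₂).smul_measure (by simp)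
    have hf := measurable_centredDist μ
    have hg := measurable_centredDist ν
    obtain ⟨i₁₁, e₁₁⟩ := integrable_centredDist_and_integral_eq ν ν₁ ν₁ o h₀ h₁ h₁
    obtain ⟨i₁₂, e₁₂⟩ := integrable_centredDist_and_integral_eq ν ν₁ ν₂ o h₀ h₁ h₂
    obtain ⟨i₂₁, e₂₁⟩ := integrable_centredDist_and_integral_eq ν ν₂ ν₁ o h₀ h₂ h₁
    obtain ⟨i₂₂, e₂₂⟩ := integrable_centredDist_and_integral_eq ν ν₂ ν₂ o h₀ h₂ h₂
    obtain ⟨j₁₁, f₁₁⟩ := integrable_and_integral_mul_dirac_prod x₁ x₁ ν₁ ν₁ _ _ hf hg i₁₁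
    obtain ⟨j₁₂, f₁₂⟩ := integrable_and_integral_mul_dirac_prod x₁ x₂ ν₁ ν₂ _ _ hf hg i₁₂
    obtain ⟨j₂₁, f₂₁⟩ := integrable_and_integral_mul_dirac_prod x₂ x₁ ν₂ ν₁ _ _ hf hg i₂₁
    obtain ⟨j₂₂, f₂₂⟩ := integrable_and_integral_mul_dirac_prod x₂ x₂ ν₂ ν₂ _ _ hf hg i₂₂
    have hswap : ∫ y, ∫ y', dist y y' ∂ν₁ ∂ν₂ = ∫ y, ∫ y', dist y y' ∂ν₂ ∂ν₁ := by
      rw [integral_integral_swap (integrable_dist_prod_s14 ν₂ ν₁ o h₂ h₁)]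
      simp only [dist_comm]
    rw [dcov, hfst, hsnd, hθ, integral_half_add_prod_self _ _ _ j₁₁ j₁₂ j₂₁ j₂₂,
      f₁₁, f₁₂, f₂₁, f₂₂, e₁₁, e₁₂, e₂₁, e₂₂, c₁₁, c₁₂, c₂₁, c₂₂, hswap]
    unfold measureD at hD
    linear_combination (-(dist x₁ x₂ / 8)) * hD
  · rw [hfst, hsnd, hθ] at h
    exact eq_of_half_dirac_prod_add_eq_prod hx ν₁ ν₂ h
end
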